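/- The binary word w₈ = ψ(φ⁸(a)), where φ is the morphism on {a,b,c} given by φ(a)=baaba, φ(b)=ca, φ(c)=bca and ψ is the morphism from {a,b,c} to {0,1} given by ψ(a)=01011, ψ(b)=ψ(c)=01001011, satisfies σ(w₈) > 2.035·|w₈|. -/

import Mathlib

open scoped Classical

namespace RunsExp

variable {α : Type*}

/-- `p` is a period of the word `w`. -/
def IsPeriod (w : List α) (p : ℕ) : Prop :=
  0 < p ∧ ∀ i : ℕ, i + p < w.length → w[i]? = w[i + p]?

/-- The shortest period of the word `w`. -/
noncomputable def minPeriod (w : List α) : ℕ := sInf {p | IsPeriod w p}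

/-- The factor `u[i..j]` of `u` (0-based indices, inclusive on both ends). -/
def factor (u : List α) (i j : ℕ) : List α := (u.drop i).take (j - i + 1)

/-- `[i..j]` is a run in `u` (0-based indices): the shortest period `p` of `u[i..j]`
satisfies `2p ≤ j-i+1` and the interval can be extended neither to the left nor to
the right without violating this property. -/
def IsRun (u : List α) (i j : ℕ) : Prop :=
  i ≤ j ∧ j < u.length ∧
  2 * minPeriod (factor u i j) ≤ j - i + 1 ∧
  (i = 0 ∨ u[i - 1]? ≠ u[i + minPeriod (factor u i j) - 1]?) ∧
  (j = u.length - 1 ∨ u[j - minPeriod (factor u i j) + 1]? ≠ u[j + 1]?)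

/-- The exponent of the run `[i..j]` of `u`. -/
noncomputable def exponent (u : List α) (i j : ℕ) : ℚ :=
  ((j : ℚ) - (i : ℚ) + 1) / (minPeriod (factor u i j) : ℚ)

/-- The set of all runs of `u`, as a finset of pairs of indices. -/
noncomputable def runs (u : List α) : Finset (ℕ × ℕ) :=
  (Finset.range u.length ×ˢ Finset.range u.length).filter fun q => IsRun u q.1 q.2

/-- The sum of exponents of all runs in `u`. -/
noncomputable def sigma (u : List α) : ℚ :=
  ∑ q ∈ runs u, exponent u q.1 q.2

/-- The lexicographically minimal word cyclically equivalent to `w`. -/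
noncomputable def minRot [LinearOrder α] (w : List α) : List α :=
  ((List.range w.length).map w.rotate).foldr min w

/-- The lexicographically maximal word cyclically equivalent to `w`. -/
noncomputable def maxRot [LinearOrder α] (w : List α) : List α :=
  ((List.range w.length).map w.rotate).foldr max w

/-- The word `x` occurs in `u` at (0-based) starting position `s`, entirely within
the interval `[i..j]`. -/
def OccursAt (u : List α) (i j : ℕ) (x : List α) (s : ℕ) : Prop :=
  i ≤ s ∧ s + x.length ≤ j + 1 ∧ factor u s (s + x.length - 1) = x

/-- `s` and `s'` are starting positions of consecutive occurrences of `x`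
inside the interval `[i..j]` of `u`. -/
def ConsecutiveOcc (u : List α) (i j : ℕ) (x : List α) (s s' : ℕ) : Prop :=
  OccursAt u i j x s ∧ OccursAt u i j x s' ∧ s < s' ∧
    ∀ t, s < t → t < s' → ¬ OccursAt u i j x t

/-- The set of handles of the run `[i..j]` of `u`: inter-position `k` lies between
the letters at positions `k` and `k+1`.  If the minimal and maximal rotations of the
period-prefix `w` coincide, all inter-positions inside the run are handles; otherwise
the handles are the inter-positions between consecutive occurrences of the minimal
rotation and between consecutive occurrences of the maximal rotation. -/
noncomputable def handles [LinearOrder α] (u : List α) (i j : ℕ) : Set ℕ :=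
  let p := minPeriod (factor u i j)
  let w := factor u i (i + p - 1)
  if minRot w = maxRot w then
    {k | i ≤ k ∧ k < j}
  else
    {k | ∃ s s', (ConsecutiveOcc u i j (minRot w) s s' ∨
                  ConsecutiveOcc u i j (maxRot w) s s') ∧ k = s' - 1}

/-- `[i..j]` is a cubic run in `u`. -/
def IsCubicRun (u : List α) (i j : ℕ) : Prop :=
  IsRun u i j ∧ 3 * minPeriod (factor u i j) ≤ j - i + 1

/-- The set of all cubic runs of `u`. -/
noncomputable def cubicRuns (u : List α) : Finset (ℕ × ℕ) :=
  (Finset.range u.length ×ˢ Finset.range u.length).filter fun q => IsCubicRun u q.1 q.2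

/-- The sum of exponents of all cubic runs in `u`. -/
noncomputable def sigmaCubic (u : List α) : ℚ :=
  ∑ q ∈ cubicRuns u, exponent u q.1 q.2


/-- The three-letter alphabet `{a, b, c}`. -/
inductive ABC : Type | a | b | c

open ABC in
/-- The morphism `φ` on `{a,b,c}`: `φ(a)=baaba`, `φ(b)=ca`, `φ(c)=bca` (values on letters). -/
def phi : ABC → List ABC
  | a => [b, a, a, b, a]
  | b => [c, a]
  | c => [b, c, a]

open ABC in
/-- The morphism `ψ : {a,b,c} → {0,1}`: `ψ(a)=01011`, `ψ(b)=ψ(c)=01001011`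
(values on letters; `0 = false`, `1 = true`). -/
def psi : ABC → List Bool
  | a => [false, true, false, true, true]
  | b => [false, true, false, false, true, false, true, true]
  | c => [false, true, false, false, true, false, true, true]

/-- The morphism `φ` extended to words by concatenation. -/
def phiW (l : List ABC) : List ABC := l.flatMap phi

/-- The morphism `ψ` extended to words by concatenation. -/
def psiW (l : List ABC) : List Bool := l.flatMap psi

/-- The binary word `w₈ = ψ(φ⁸(a))`. -/
def w8 : List Bool := psiW (phiW^[8] [ABC.a])


/-! ### Computable bit-parallel certificate -/

/-- Erosion: bit `i` of `er x f p` says that bits `i, …, i+p-1` of `x` are all set. -/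
def er (x : ℕ) : ℕ → ℕ → ℕ
  | 0, _ => x
  | f + 1, p =>
    cond (Nat.ble p 1) x
      (Nat.land (er x f ((p + 1) / 2)) (Nat.shiftRight (er x f ((p + 1) / 2)) (p - (p + 1) / 2)))

/-- Bit `i` says that `i + p < n` and the letters at `i` and `i + p` agree. -/
def eqm (V n p : ℕ) : ℕ :=
  Nat.xor (2 ^ (n - p) - 1) (Nat.mod (Nat.xor V (Nat.shiftRight V p)) (2 ^ (n - p)))

/-- Positions of squares of period `p`. -/
def sq (V n p : ℕ) : ℕ := er (eqm V n p) 16 p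

/-- Starting positions of blocks of ones. -/
def starts (R : ℕ) : ℕ := Nat.xor R (Nat.land R (Nat.shiftLeft R 1))

/-- Bit-sliced addition of the low and high halves of a list of bit planes. -/
def addc (M : ℕ) : List ℕ → ℕ → List ℕ
  | [], c => [c]
  | x :: xs, c =>
    Nat.xor (Nat.xor (Nat.mod x (2 ^ M)) (Nat.shiftRight x M)) c ::
      addc M xs (Nat.lor (Nat.land (Nat.mod x (2 ^ M)) (Nat.shiftRight x M))
        (Nat.land c (Nat.xor (Nat.mod x (2 ^ M)) (Nat.shiftRight x M))))

/-- Fold the bit planes down to width one. -/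
def lvl : ℕ → List ℕ → List ℕ
  | 0, l => l
  | k + 1, l => lvl k (addc (2 ^ k) l 0)

/-- Final value of bit planes of width one. -/
def horner : List ℕ → ℕ
  | [] => 0
  | x :: xs => x % 2 + 2 * horner xs

/-- Number of ones among the first `2 ^ 19` bits. -/
def popc (x : ℕ) : ℕ := horner (lvl 19 [x])

/-- Check a Boolean property on `[lo, lo + 2 ^ k)`. -/
def allR (f : ℕ → Bool) : ℕ → ℕ → Bool
  | 0, lo => f lo
  | k + 1, lo => cond (allR f k lo) (allR f k (lo + 2 ^ k)) false

/-- No square of period `p` has period `d`, for `d < p`. -/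
def primOk1 (V n p R d : ℕ) : Bool :=
  cond (Nat.ble p d) true (Nat.beq (Nat.land R (er (eqm V n d) 16 p)) 0)

/-- If `d` divides `p`, check both `d` and `p / d`. -/
def primOk (V n p R d : ℕ) : Bool :=
  cond (Nat.beq (p % d) 0) (cond (primOk1 V n p R d) (primOk1 V n p R (p / d)) false) true

/-- Certified contribution (times 1000, rounded down) of the runs of period `p`. -/
def contrib (V n p : ℕ) : ℕ :=
  cond (Nat.ble 1 p)
    (cond (Nat.ble p 65535)
      (cond (allR (primOk V n p (sq V n p)) 8 0)
        (1000 * (popc (sq V n p) + (2 * p - 1) * popc (starts (sq V n p))) / p) 0) 0) 0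

/-- Concatenation of encoded words (value, length). -/
def cat (x y : ℕ × ℕ) : ℕ × ℕ := (x.1 + 2 ^ x.2 * y.1, x.2 + y.2)

/-- Encodings of `ψ(φᵏ(a))`, `ψ(φᵏ(b))`, `ψ(φᵏ(c))`. -/
def enc : ℕ → ABC → ℕ × ℕ
  | 0, ABC.a => (26, 5)
  | 0, ABC.b => (210, 8)
  | 0, ABC.c => (210, 8)
  | k + 1, ABC.a => cat (enc k ABC.b) (cat (enc k ABC.a) (cat (enc k ABC.a) (cat (enc k ABC.b) (enc k ABC.a))))
  | k + 1, ABC.b => cat (enc k ABC.c) (enc k ABC.a)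
  | k + 1, ABC.c => cat (enc k ABC.b) (cat (enc k ABC.c) (enc k ABC.a))

/-- The word `w8` as a number. -/
def V8 : ℕ := (enc 8 ABC.a).1

/-- The periods that we use. -/
def periods : List ℕ :=
  [1, 2, 3, 5, 8, 13, 18, 21, 31, 34, 44, 52, 65, 75, 96, 109, 119, 171, 184, 236, 290, 355, 461,
    645, 697, 881, 1106, 1342, 1751, 2448, 2632, 3329, 4199, 5080, 6647, 9279, 9976, 12608, 15926,
    19255, 25205]

/-! ### Correctness of the bit operations -/

theorem er_spec (x : ℕ) : ∀ (f p i : ℕ), 1 ≤ p → p ≤ 2 ^ f →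
    ((er x f p).testBit i = true ↔ ∀ k < p, x.testBit (i + k) = true) := by
  intro f
  induction f with
  | zero =>
    intro p i h1 h2
    have hp : p = 1 := by simp at h2; omega
    subst hp
    simp [er]
  | succ f ih =>
    intro p i h1 h2
    by_cases hp : p ≤ 1
    · have hp : p = 1 := by omega
      subst hp
      have e : er x (f + 1) 1 = x := rfl
      rw [e]
      simp
    · have hb : Nat.ble p 1 = false := by
        rw [Bool.eq_false_iff]; intro h; exact hp (Nat.le_of_ble_eq_true h)
      have hf : 2 ^ (f + 1) = 2 * 2 ^ f := by ring
      have e : er x (f + 1) p = (er x f ((p + 1) / 2)) &&& ((er x f ((p + 1) / 2)) >>> (p - (p + 1) / 2)) := by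
        simp only [er, hb, cond_false]; rfl
      rw [e, Nat.testBit_and, Nat.testBit_shiftRight, Bool.and_eq_true,
        ih _ _ (by omega) (by omega), ih _ _ (by omega) (by omega)]
      constructor
      · rintro ⟨ha, hb⟩ k hk
        by_cases hk2 : k < (p + 1) / 2
        · exact ha k hk2
        · have := hb (k - (p - (p + 1) / 2)) (by omega)
          have e : p - (p + 1) / 2 + i + (k - (p - (p + 1) / 2)) = i + k := by omega
          rwa [e] at this
      · intro h
        refine ⟨fun k hk => h k (by omega), fun k hk => ?_⟩
        have := h (p - (p + 1) / 2 + k) (by omega)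
        have e : p - (p + 1) / 2 + i + k = i + (p - (p + 1) / 2 + k) := by omega
        rwa [e]

theorem eqm_spec (V n p i : ℕ) :
    (eqm V n p).testBit i = true ↔ i + p < n ∧ V.testBit i = V.testBit (i + p) := by
  have e : eqm V n p = (2 ^ (n - p) - 1) ^^^ ((V ^^^ (V >>> p)) % 2 ^ (n - p)) := rfl
  rw [e, Nat.testBit_xor, Nat.testBit_two_pow_sub_one, Nat.testBit_mod_two_pow, Nat.testBit_xor,
    Nat.testBit_shiftRight, Nat.add_comm p i]
  by_cases h : i + p < n
  · have hlt : i < n - p := by omega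
    simp only [h, hlt, decide_true, true_and]
    cases V.testBit i <;> cases V.testBit (i + p) <;> simp
  · have hlt : ¬ i < n - p := by omega
    simp [h, hlt]

/-- Square of period `p` at position `i`. -/
def Q (V n p i : ℕ) : Prop := ∀ k < p, i + k + p < n ∧ V.testBit (i + k) = V.testBit (i + k + p)

theorem sq_spec (V n p i : ℕ) (h1 : 1 ≤ p) (h2 : p ≤ 2 ^ 16) :
    (sq V n p).testBit i = true ↔ Q V n p i := by
  unfold sq Q
  rw [er_spec _ _ _ _ h1 h2]
  simp only [eqm_spec]

theorem starts_spec (R i : ℕ) :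
    (starts R).testBit i = true ↔ R.testBit i = true ∧ (i = 0 ∨ ¬ R.testBit (i - 1) = true) := by
  have e : starts R = R ^^^ (R &&& (R <<< 1)) := rfl
  rw [e, Nat.testBit_xor, Nat.testBit_and, Nat.testBit_shiftLeft]
  rcases Nat.eq_zero_or_pos i with h | h
  · subst h; simp
  · have h0 : i ≠ 0 := by omega
    have h1 : i ≥ 1 := h
    simp only [h0, h1, decide_true, Bool.true_and, false_or]
    cases R.testBit i <;> cases R.testBit (i - 1) <;> simp

/-- Number of ones among the first `M` bits. -/
def PC (M x : ℕ) : ℕ := ∑ i ∈ Finset.range M, (x.testBit i).toNat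

/-- Weighted number of ones in a list of bit planes. -/
def weight (M : ℕ) : List ℕ → ℕ
  | [] => 0
  | x :: xs => PC M x + 2 * weight M xs

theorem PC_double (M x : ℕ) : PC (2 * M) x = PC M (x % 2 ^ M) + PC M (x >>> M) := by
  unfold PC
  rw [two_mul, Finset.sum_range_add]
  congr 1
  · apply Finset.sum_congr rfl
    intro i hi
    rw [Finset.mem_range] at hi
    simp [Nat.testBit_mod_two_pow, hi]
  · apply Finset.sum_congr rfl
    intro i _
    rw [Nat.testBit_shiftRight]

theorem PC_add (M a b c : ℕ) :
    PC M ((a ^^^ b) ^^^ c) + 2 * PC M ((a &&& b) ||| (c &&& (a ^^^ b))) = PC M a + PC M b + PC M c := by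
  unfold PC
  rw [Finset.mul_sum, ← Finset.sum_add_distrib, ← Finset.sum_add_distrib, ← Finset.sum_add_distrib]
  apply Finset.sum_congr rfl
  intro i _
  simp only [Nat.testBit_xor, Nat.testBit_and, Nat.testBit_or]
  cases a.testBit i <;> cases b.testBit i <;> cases c.testBit i <;> rfl

theorem weight_addc (M : ℕ) : ∀ (l : List ℕ) (c : ℕ),
    weight M (addc M l c) = weight (2 * M) l + PC M c := by
  intro l
  induction l with
  | nil => intro c; simp [addc, weight]
  | cons x xs ih =>
    intro c
    have h := PC_add M (x % 2 ^ M) (x >>> M) c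
    simp only [addc, weight, ih, PC_double]
    have e : PC M (Nat.xor (Nat.xor (Nat.mod x (2 ^ M)) (Nat.shiftRight x M)) c) =
      PC M (((x % 2 ^ M) ^^^ (x >>> M)) ^^^ c) := rfl
    have e2 : PC M (Nat.lor (Nat.land (Nat.mod x (2 ^ M)) (Nat.shiftRight x M))
        (Nat.land c (Nat.xor (Nat.mod x (2 ^ M)) (Nat.shiftRight x M)))) =
      PC M (((x % 2 ^ M) &&& (x >>> M)) ||| (c &&& ((x % 2 ^ M) ^^^ (x >>> M)))) := rfl
    rw [e, e2]
    omega

theorem PC_zero (M : ℕ) : PC M 0 = 0 := by simp [PC]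

theorem weight_lvl : ∀ (k : ℕ) (l : List ℕ), weight 1 (lvl k l) = weight (2 ^ k) l := by
  intro k
  induction k with
  | zero => intro l; rfl
  | succ k ih =>
    intro l
    rw [lvl, ih, weight_addc, PC_zero, pow_succ, mul_comm 2]
    rfl

theorem horner_eq (l : List ℕ) : horner l = weight 1 l := by
  induction l with
  | nil => rfl
  | cons x xs ih =>
    have : PC 1 x = x % 2 := by
      simp only [PC, Finset.sum_range_one, Nat.testBit_zero]
      rcases Nat.mod_two_eq_zero_or_one x with h | h <;> simp [h]
    simp [horner, weight, ih, this]

theorem popc_eq (x : ℕ) :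
    popc x = ((Finset.range (2 ^ 19)).filter (fun i => x.testBit i = true)).card := by
  unfold popc
  rw [horner_eq, weight_lvl, weight, weight, Finset.card_filter, PC]
  simp only [mul_zero, add_zero]
  apply Finset.sum_congr rfl
  intro i _
  cases x.testBit i <;> simp

theorem allR_spec (f : ℕ → Bool) : ∀ (k lo : ℕ), allR f k lo = true →
    ∀ d, lo ≤ d → d < lo + 2 ^ k → f d = true := by
  intro k
  induction k with
  | zero =>
    intro lo h d h1 h2
    have : d = lo := by simp at h2; omega
    subst this
    exact h
  | succ k ih =>
    intro lo h d h1 h2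
    rw [allR] at h
    have h3 : d < lo + (2 ^ k + 2 ^ k) := by rw [pow_succ, mul_two] at h2; exact h2
    cases hc : allR f k lo with
    | false => rw [hc] at h; simp at h
    | true =>
      rw [hc] at h
      by_cases hd : d < lo + 2 ^ k
      · exact ih lo hc d h1 hd
      · exact ih (lo + 2 ^ k) h d (by omega) (by omega)

/-- Primitivity: a square of period `p` has no proper divisor of `p` as a period. -/
theorem prim_spec (V n p : ℕ) (h1 : 1 ≤ p) (h2 : p ≤ 65535)
    (h : allR (primOk V n p (sq V n p)) 8 0 = true) (d : ℕ) (hd : d ∣ p) (hdp : d < p) (i : ℕ)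
    (hQ : Q V n p i) : ∃ k < p, ¬ (i + k + d < n ∧ V.testBit (i + k) = V.testBit (i + k + d)) := by
  have hok : primOk1 V n p (sq V n p) d = true := by
    obtain ⟨e, he⟩ := hd
    have hd0 : 0 < d := by rcases Nat.eq_zero_or_pos d with h | h; · simp [h] at he; omega
                           · exact h
    have he0 : 0 < e := by rcases Nat.eq_zero_or_pos e with h | h; · simp [h] at he; omega
                           · exact h
    have hcase : d < 256 ∨ e < 256 := by
      by_contra! hc
      have := Nat.mul_le_mul hc.1 hc.2
      omega
    have key : ∀ a b, 0 < a → p = a * b → a < 256 →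
        primOk1 V n p (sq V n p) a = true ∧ primOk1 V n p (sq V n p) b = true := by
      intro a b ha hab ha2
      have := allR_spec _ 8 0 h a (by omega) (by simpa using ha2)
      have hm : p % a = 0 := by rw [hab]; simp
      have hq : p / a = b := by rw [hab]; exact Nat.mul_div_cancel_left b ha
      rw [primOk, hm, hq] at this
      cases hc : primOk1 V n p (sq V n p) a with
      | false => rw [hc] at this; simp at this
      | true => rw [hc] at this; exact ⟨rfl, by simpa using this⟩
    rcases hcase with hc | hc
    · exact (key d e hd0 he hc).1
    · exact (key e d he0 (by rw [he, mul_comm]) hc).2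
  by_contra! hcon
  have hb : Nat.ble p d = false := by
    rw [Bool.eq_false_iff]; intro h; exact absurd (Nat.le_of_ble_eq_true h) (by omega)
  rw [primOk1, hb, cond_false] at hok
  have h0 : (sq V n p) &&& (er (eqm V n d) 16 p) = 0 := Nat.eq_of_beq_eq_true hok
  have hbit : ((sq V n p) &&& (er (eqm V n d) 16 p)).testBit i = true := by
    rw [Nat.testBit_and, Bool.and_eq_true]
    refine ⟨(sq_spec V n p i h1 (by norm_num; omega)).2 hQ, ?_⟩
    rw [er_spec _ _ _ _ h1 (by norm_num; omega)]
    intro k hk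
    rw [eqm_spec]
    exact hcon k hk
  rw [h0] at hbit
  simp at hbit

/-! ### Encoding of the word -/

/-- Value of a binary word, least significant bit first. -/
def val : List Bool → ℕ
  | [] => 0
  | b :: l => b.toNat + 2 * val l

theorem val_append (l m : List Bool) : val (l ++ m) = val l + 2 ^ l.length * val m := by
  induction l with
  | nil => simp [val]
  | cons b l ih => simp only [List.cons_append, val, ih, List.length_cons, pow_succ]; ring

theorem val_testBit (l : List Bool) : ∀ i, i < l.length → l[i]? = some ((val l).testBit i) := by
  induction l with
  | nil => intro i h; simp at h
  | cons b l ih =>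
    intro i h
    cases i with
    | zero =>
      simp only [List.getElem?_cons_zero, val, Nat.testBit_zero]
      cases b <;> simp
    | succ i =>
      rw [List.getElem?_cons_succ, ih i (by simpa using h), Nat.testBit_succ]
      congr 2
      cases b <;> simp [val] <;> omega

theorem phiW_append (l m : List ABC) : phiW (l ++ m) = phiW l ++ phiW m := by
  simp [phiW]

theorem phiW_iter_append (k : ℕ) : ∀ (l m : List ABC),
    phiW^[k] (l ++ m) = phiW^[k] l ++ phiW^[k] m := by
  induction k with
  | zero => intro l m; rfl
  | succ k ih => intro l m; simp only [Function.iterate_succ_apply, phiW_append, ih]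

/-- The encoded pair. -/
def code (l : List Bool) : ℕ × ℕ := (val l, l.length)

theorem code_append (l m : List Bool) : code (l ++ m) = cat (code l) (code m) := by
  simp [code, cat, val_append]

/-- `ψ ∘ φᵏ`. -/
def im (k : ℕ) (l : List ABC) : List Bool := psiW (phiW^[k] l)

theorem im_append (k : ℕ) (l m : List ABC) : im k (l ++ m) = im k l ++ im k m := by
  simp [im, phiW_iter_append, psiW]

theorem im_cons (k : ℕ) (x y : ABC) (l : List ABC) : im k (x :: y :: l) = im k [x] ++ im k (y :: l) :=
  im_append k [x] (y :: l)

theorem im_succ (k : ℕ) (x : ABC) : im (k + 1) [x] = im k (phi x) := by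
  simp [im, Function.iterate_succ_apply, phiW]

theorem enc_eq (k : ℕ) : ∀ x, enc k x = code (im k [x]) := by
  induction k with
  | zero => intro x; cases x <;> rfl
  | succ k ih =>
    intro x
    rw [im_succ]
    cases x <;> simp only [enc, phi, im_cons, code_append, ih]

theorem w8_code : code w8 = enc 8 ABC.a := (enc_eq 8 ABC.a).symm

theorem w8_len : w8.length = 362327 := by
  have h : (code w8).2 = 362327 := by rw [w8_code]; decide +kernel
  exact h

theorem w8_val : val w8 = V8 := by
  have h : (code w8).1 = V8 := by rw [w8_code]; rfl
  exact h

/-! ### Runs -/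

/-- Weak Fine–Wilf theorem (via subtractive Euclid). -/
theorem period_gcd {u : ℕ → Bool} (L : ℕ) : ∀ (s p q : ℕ), p + q ≤ s → 0 < p → 0 < q → p + q ≤ L →
    (∀ i, i + p < L → u i = u (i + p)) → (∀ i, i + q < L → u i = u (i + q)) →
    ∀ i, i + Nat.gcd p q < L → u i = u (i + Nat.gcd p q) := by
  intro s
  induction s with
  | zero => intro p q h hp; omega
  | succ s ih =>
    have aux : ∀ p q, p + q ≤ s + 1 → 0 < p → p < q → p + q ≤ L →
        (∀ i, i + p < L → u i = u (i + p)) → (∀ i, i + q < L → u i = u (i + q)) →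
        ∀ i, i + Nat.gcd p q < L → u i = u (i + Nat.gcd p q) := by
      intro p q hs hp hpq hL h1 h2
      have hg : Nat.gcd p q = Nat.gcd p (q - p) := by
        conv_lhs => rw [show q = (q - p) + p by omega]
        simp
      rw [hg]
      refine ih p (q - p) (by omega) hp (by omega) (by omega) h1 ?_
      intro i hi
      by_cases hip : p ≤ i
      · have a := h1 (i - p) (by omega)
        have b := h2 (i - p) (by omega)
        rw [show i - p + p = i by omega] at a
        rw [show i - p + q = i + (q - p) by omega] at b
        rw [← a, b]
      · have a := h2 i (by omega)
        have b := h1 (i + (q - p)) (by omega)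
        rw [show i + (q - p) + p = i + q by omega] at b
        rw [a, b]
    intro p q hs hp hq hL h1 h2
    rcases lt_trichotomy p q with h | h | h
    · exact aux p q hs hp h hL h1 h2
    · subst h; simpa using h1
    · rw [Nat.gcd_comm]
      exact aux q p (by omega) hq h (by omega) h2 h1

theorem factor_length (u : List Bool) (i j : ℕ) (hij : i ≤ j) (hj : j < u.length) :
    (factor u i j).length = j - i + 1 := by
  simp only [factor, List.length_take, List.length_drop]; omega

theorem factor_get (u : List Bool) (i j k : ℕ) (hk : k < j - i + 1) :
    (factor u i j)[k]? = u[i + k]? := by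
  rw [factor, List.getElem?_take_of_lt hk, List.getElem?_drop]

/-- `u` is encoded by the number `V`. -/
def Enc (u : List Bool) (V : ℕ) : Prop := ∀ i, i < u.length → u[i]? = some (V.testBit i)

theorem isPeriod_factor {u : List Bool} {V : ℕ} (hu : Enc u V) (i j p : ℕ) (hij : i ≤ j)
    (hj : j < u.length) :
    IsPeriod (factor u i j) p ↔
      0 < p ∧ ∀ k, k + p < j - i + 1 → V.testBit (i + k) = V.testBit (i + (k + p)) := by
  unfold IsPeriod
  rw [factor_length u i j hij hj]
  refine and_congr_right fun hp => forall_congr' fun k => ?_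
  refine forall_congr' fun hk => ?_
  rw [factor_get _ _ _ _ (by omega), factor_get _ _ _ _ hk, hu _ (by omega), hu _ (by omega)]
  simp

/-- Data of a maximal block `[s, e]` of squares of period `p`. -/
theorem block_run {u : List Bool} {V : ℕ} (hu : Enc u V) (p s e : ℕ) (hp : 1 ≤ p) (hse : s ≤ e)
    (hQ : ∀ t, s ≤ t → t ≤ e → Q V u.length p t)
    (hl : s = 0 ∨ ¬ Q V u.length p (s - 1)) (hr : ¬ Q V u.length p (e + 1))
    (hprim : ∀ d, d ∣ p → d < p →
      ∃ k < p, ¬ (s + k + d < u.length ∧ V.testBit (s + k) = V.testBit (s + k + d))) :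
    minPeriod (factor u s (e + 2 * p - 1)) = p ∧ IsRun u s (e + 2 * p - 1) := by
  have hn : e + 2 * p ≤ u.length := by
    have := (hQ e hse le_rfl (p - 1) (by omega)).1
    omega
  have hj : e + 2 * p - 1 < u.length := by omega
  have hij : s ≤ e + 2 * p - 1 := by omega
  have hlen : e + 2 * p - 1 - s + 1 = e - s + 2 * p := by omega
  have hper : ∀ k, k < e - s + p → V.testBit (s + k) = V.testBit (s + k + p) := by
    intro k hk
    by_cases h : k ≤ e - s
    · have := (hQ (s + k) (by omega) (by omega) 0 (by omega)).2
      simpa using this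
    · have := (hQ e hse le_rfl (s + k - e) (by omega)).2
      rwa [show e + (s + k - e) = s + k by omega] at this
  have hmin : minPeriod (factor u s (e + 2 * p - 1)) = p := by
    have hP : IsPeriod (factor u s (e + 2 * p - 1)) p := by
      rw [isPeriod_factor hu _ _ _ hij hj, hlen]
      refine ⟨hp, fun k hk => ?_⟩
      rw [hper k (by omega), Nat.add_assoc]
    refine le_antisymm (Nat.sInf_le hP) ?_
    by_contra! hlt
    have hq : IsPeriod (factor u s (e + 2 * p - 1)) (minPeriod (factor u s (e + 2 * p - 1))) :=
      Nat.sInf_mem (s := {q | IsPeriod (factor u s (e + 2 * p - 1)) q}) ⟨p, hP⟩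
    generalize minPeriod (factor u s (e + 2 * p - 1)) = q at hlt hq
    rw [isPeriod_factor hu _ _ _ hij hj, hlen] at hq
    rw [isPeriod_factor hu _ _ _ hij hj, hlen] at hP
    have hg := period_gcd (u := fun k => V.testBit (s + k)) (e - s + 2 * p) (p + q) p q le_rfl hp hq.1
      (by omega) hP.2 hq.2
    have hgq : Nat.gcd p q ≤ q := Nat.gcd_le_right p hq.1
    obtain ⟨k, hk, hk2⟩ := hprim (Nat.gcd p q) (Nat.gcd_dvd_left p q) (by omega)
    apply hk2
    refine ⟨by omega, ?_⟩
    have := hg k (by omega)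
    simpa [Nat.add_assoc] using this
  refine ⟨hmin, hij, hj, ?_, ?_, ?_⟩
  · rw [hmin]; omega
  · rw [hmin]
    by_cases hs : s = 0
    · left; exact hs
    · right
      have hl := hl.resolve_left hs
      rw [hu _ (by omega), hu _ (by omega)]
      intro heq
      apply hl
      intro k hk
      refine ⟨by omega, ?_⟩
      rcases Nat.eq_zero_or_pos k with h | h
      · subst h
        have := Option.some.inj heq
        rwa [show s + p - 1 = s - 1 + 0 + p by omega] at this
      · have := hper (k - 1) (by omega)
        rwa [show s + (k - 1) = s - 1 + k by omega] at this
  · rw [hmin]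
    by_cases hs : e + 2 * p = u.length
    · left; omega
    · right
      rw [hu _ (by omega), hu _ (by omega)]
      intro heq
      apply hr
      intro k hk
      refine ⟨by omega, ?_⟩
      by_cases h : k = p - 1
      · subst h
        have := Option.some.inj heq
        rwa [show e + 2 * p - 1 - p + 1 = e + 1 + (p - 1) by omega,
          show e + 2 * p - 1 + 1 = e + 1 + (p - 1) + p by omega] at this
      · have := hper (e + 1 + k - s) (by omega)
        rwa [show s + (e + 1 + k - s) = e + 1 + k by omega] at this

theorem exists_end {P : ℕ → Prop} (n : ℕ) (hP : ∀ i, P i → i < n) (s : ℕ) (hs : P s) :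
    ∃ e, s ≤ e ∧ (∀ t, s ≤ t → t ≤ e → P t) ∧ ¬ P (e + 1) := by
  have hex : ∃ m, ¬ P (s + m + 1) := ⟨n, fun h => by have := hP _ h; omega⟩
  refine ⟨s + Nat.find hex, by omega, ?_, Nat.find_spec hex⟩
  intro t h1 h2
  rcases Nat.eq_or_lt_of_le h1 with h | h
  · rwa [← h]
  · have := Nat.find_min hex (m := t - s - 1) (by omega)
    rw [not_not] at this
    rwa [show s + (t - s - 1) + 1 = t by omega] at this

theorem exists_start {P : ℕ → Prop} : ∀ (i : ℕ), P i →
    ∃ s, s ≤ i ∧ (∀ t, s ≤ t → t ≤ i → P t) ∧ (s = 0 ∨ ¬ P (s - 1)) := by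
  intro i
  induction i with
  | zero => intro h; exact ⟨0, le_rfl, fun t _ ht => by rwa [show t = 0 by omega], Or.inl rfl⟩
  | succ i ih =>
    intro h
    by_cases hi : P i
    · obtain ⟨s, h1, h2, h3⟩ := ih hi
      refine ⟨s, by omega, fun t ht1 ht2 => ?_, h3⟩
      rcases Nat.eq_or_lt_of_le ht2 with h' | h'
      · rwa [h']
      · exact h2 t ht1 (by omega)
    · refine ⟨i + 1, le_rfl, fun t ht1 ht2 => ?_, Or.inr (by simpa using hi)⟩
      rwa [show t = i + 1 by omega]

theorem contrib_le {u : List Bool} {V : ℕ} (hu : Enc u V) (hn : u.length ≤ 2 ^ 19) (p : ℕ) :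
    (contrib V u.length p : ℚ) ≤
      1000 * ∑ q ∈ (runs u).filter (fun q => minPeriod (factor u q.1 q.2) = p), exponent u q.1 q.2 := by
  have hnn : (0 : ℚ) ≤
      1000 * ∑ q ∈ (runs u).filter (fun q => minPeriod (factor u q.1 q.2) = p), exponent u q.1 q.2 := by
    refine mul_nonneg (by norm_num) (Finset.sum_nonneg fun q hq => ?_)
    rw [Finset.mem_filter, runs, Finset.mem_filter] at hq
    have : (q.1 : ℚ) ≤ q.2 := by exact_mod_cast hq.1.2.1
    unfold exponent
    apply div_nonneg
    · linarith
    · exact Nat.cast_nonneg _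
  unfold contrib
  cases h1 : Nat.ble 1 p with
  | false => simpa using hnn
  | true =>
  cases h2 : Nat.ble p 65535 with
  | false => simpa using hnn
  | true =>
  cases h3 : allR (primOk V u.length p (sq V u.length p)) 8 0 with
  | false => simpa using hnn
  | true =>
  simp only [cond_true]
  replace h1 := Nat.le_of_ble_eq_true h1
  replace h2 := Nat.le_of_ble_eq_true h2
  have hprim := prim_spec V u.length p h1 h2 h3
  have hbound : ∀ i, Q V u.length p i → i < u.length := by
    intro i hi
    have := (hi 0 (by omega)).1
    omega
  rw [popc_eq, popc_eq]
  simp only [starts_spec, sq_spec V u.length p _ h1 (show p ≤ 2 ^ 16 by norm_num; omega)]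
  generalize 2 ^ 19 = N at hn ⊢
  set R := (Finset.range N).filter (fun i => Q V u.length p i) with hR
  set S := (Finset.range N).filter
    (fun i => Q V u.length p i ∧ (i = 0 ∨ ¬ Q V u.length p (i - 1))) with hS
  have hSm : ∀ s, s ∈ S ↔ Q V u.length p s ∧ (s = 0 ∨ ¬ Q V u.length p (s - 1)) := by
    intro s
    rw [hS, Finset.mem_filter, Finset.mem_range]
    constructor
    · exact fun h => h.2
    · intro h
      exact ⟨lt_of_lt_of_le (hbound s h.1) hn, h⟩
  have hend : ∀ s, ∃ e, s ∈ S → s ≤ e ∧ (∀ t, s ≤ t → t ≤ e → Q V u.length p t) ∧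
      ¬ Q V u.length p (e + 1) := by
    intro s
    by_cases hs : s ∈ S
    · obtain ⟨e, he⟩ := exists_end (P := Q V u.length p) u.length hbound s ((hSm s).1 hs).1
      exact ⟨e, fun _ => he⟩
    · exact ⟨0, fun h => absurd h hs⟩
  choose e he using hend
  have hrun : ∀ s ∈ S, minPeriod (factor u s (e s + 2 * p - 1)) = p ∧ IsRun u s (e s + 2 * p - 1) := by
    intro s hs
    obtain ⟨a, b, c⟩ := he s hs
    have hs' := (hSm s).1 hs
    exact block_run hu p s (e s) h1 a b hs'.2 c (fun d hd hdp => hprim d hd hdp s hs'.1)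
  -- covering
  have hcov : R.card ≤ ∑ s ∈ S, (e s - s + 1) := by
    have hsub : R ⊆ S.biUnion (fun s => Finset.Icc s (e s)) := by
      intro i hi
      rw [hR, Finset.mem_filter] at hi
      obtain ⟨s, a, b, c⟩ := exists_start (P := Q V u.length p) i hi.2
      have hs : s ∈ S := (hSm s).2 ⟨b s le_rfl a, c⟩
      rw [Finset.mem_biUnion]
      refine ⟨s, hs, ?_⟩
      rw [Finset.mem_Icc]
      refine ⟨a, ?_⟩
      by_contra! hlt
      exact (he s hs).2.2 (b _ (by have := (he s hs).1; omega) (by omega))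
    refine (Finset.card_le_card hsub).trans (Finset.card_biUnion_le.trans ?_)
    apply Finset.sum_le_sum
    intro s hs
    rw [Nat.card_Icc]
    have := (he s hs).1
    omega
  have hp0 : (0 : ℚ) < p := by exact_mod_cast h1
  have hsum : (∑ s ∈ S, ((e s - s + 1 + (2 * p - 1) : ℕ) : ℚ) / p) ≤
      ∑ q ∈ (runs u).filter (fun q => minPeriod (factor u q.1 q.2) = p), exponent u q.1 q.2 := by
    have himg : ∑ q ∈ S.image (fun s => (s, e s + 2 * p - 1)), exponent u q.1 q.2 =
        ∑ s ∈ S, ((e s - s + 1 + (2 * p - 1) : ℕ) : ℚ) / p := by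
      rw [Finset.sum_image (by intro a _ b _ h; exact (Prod.mk.inj h).1)]
      apply Finset.sum_congr rfl
      intro s hs
      have h5 := (he s hs).1
      simp only [exponent, (hrun s hs).1]
      congr 1
      have : e s - s + 1 + (2 * p - 1) + s = (e s + 2 * p - 1) + 1 := by omega
      have h6 : ((e s - s + 1 + (2 * p - 1) : ℕ) : ℚ) + s = ((e s + 2 * p - 1 : ℕ) : ℚ) + 1 := by
        exact_mod_cast this
      linarith
    rw [← himg]
    refine Finset.sum_le_sum_of_subset_of_nonneg ?_ ?_
    · intro q hq
      rw [Finset.mem_image] at hq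
      obtain ⟨s, hs, rfl⟩ := hq
      obtain ⟨a, b⟩ := hrun s hs
      rw [Finset.mem_filter, runs, Finset.mem_filter, Finset.mem_product, Finset.mem_range,
        Finset.mem_range]
      exact ⟨⟨⟨lt_of_le_of_lt b.1 b.2.1, b.2.1⟩, b⟩, a⟩
    · intro q hq _
      rw [Finset.mem_filter, runs, Finset.mem_filter] at hq
      have : (q.1 : ℚ) ≤ q.2 := by exact_mod_cast hq.1.2.1
      unfold exponent
      apply div_nonneg
      · linarith
      · exact Nat.cast_nonneg _
  have hcnt : R.card + (2 * p - 1) * S.card ≤ ∑ s ∈ S, (e s - s + 1 + (2 * p - 1)) := by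
    rw [Finset.sum_add_distrib, Finset.sum_const, smul_eq_mul, mul_comm S.card]
    omega
  calc ((1000 * (R.card + (2 * p - 1) * S.card) / p : ℕ) : ℚ)
      ≤ ((1000 * (R.card + (2 * p - 1) * S.card) : ℕ) : ℚ) / p := Nat.cast_div_le
    _ ≤ ((1000 * ∑ s ∈ S, (e s - s + 1 + (2 * p - 1)) : ℕ) : ℚ) / p := by
        gcongr
    _ = 1000 * ∑ s ∈ S, ((e s - s + 1 + (2 * p - 1) : ℕ) : ℚ) / p := by
        rw [← Finset.sum_div, Nat.cast_mul, Nat.cast_sum, mul_div_assoc]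
        norm_num
    _ ≤ _ := by
        gcongr

theorem sum_contrib_le {u : List Bool} {V : ℕ} (hu : Enc u V) (hn : u.length ≤ 2 ^ 19)
    (P : List ℕ) (hP : P.Nodup) :
    ((P.map (contrib V u.length)).sum : ℚ) ≤ 1000 * sigma u := by
  have h1 : (P.map (contrib V u.length)).sum = ∑ p ∈ P.toFinset, contrib V u.length p :=
    (List.sum_toFinset _ hP).symm
  rw [h1, Nat.cast_sum]
  calc ∑ p ∈ P.toFinset, (contrib V u.length p : ℚ)
      ≤ ∑ p ∈ P.toFinset, 1000 * ∑ q ∈ (runs u).filter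
          (fun q => minPeriod (factor u q.1 q.2) = p), exponent u q.1 q.2 :=
        Finset.sum_le_sum fun p _ => contrib_le hu hn p
    _ = 1000 * ∑ q ∈ (runs u).filter
          (fun q => minPeriod (factor u q.1 q.2) ∈ P.toFinset), exponent u q.1 q.2 := by
        rw [← Finset.mul_sum, Finset.sum_fiberwise_eq_sum_filter]
    _ ≤ 1000 * sigma u := by
        unfold sigma
        gcongr ?_ * ?_
        refine Finset.sum_le_sum_of_subset_of_nonneg (Finset.filter_subset _ _) ?_
        intro q hq _
        rw [runs, Finset.mem_filter] at hq
        have : (q.1 : ℚ) ≤ q.2 := by exact_mod_cast hq.2.1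
        unfold exponent
        apply div_nonneg
        · linarith
        · exact Nat.cast_nonneg _

theorem key : 2035 * 362327 < (periods.map (contrib V8 362327)).sum := by decide +kernel

/-- The binary word `w₈ = ψ(φ⁸(a))` satisfies `σ(w₈) > 2.035 |w₈|`. -/
theorem sigma_w8_gt :
    sigma w8 > (2.035 : ℚ) * (w8.length : ℚ) := by
  have hu : Enc w8 V8 := by
    intro i hi
    rw [val_testBit w8 i hi, w8_val]
  have h := sum_contrib_le hu (by rw [w8_len]; norm_num) periods (by decide)
  rw [w8_len] at h ⊢
  have hk : ((2035 * 362327 : ℕ) : ℚ) < ((periods.map (contrib V8 362327)).sum : ℕ) := by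
    exact_mod_cast key
  have hk2 : ((2035 * 362327 : ℕ) : ℚ) = 1000 * ((2.035 : ℚ) * ((362327 : ℕ) : ℚ)) := by norm_num
  rw [hk2] at hk
  linarith
end RunsExp
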